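/- Theorem 2 (exponential tracking for the unstable Burgers equation, linear feedback). Let ν > 0, k > 0, and set λ = min(ν, k). Let a, u_d : ℝ × ℝ → ℝ be continuous, r : ℝ → ℝ continuously differentiable, and u₀ : ℝ → ℝ continuous on [0,1]. Let û, U : ℝ × ℝ → ℝ be twice continuously differentiable and satisfy, for all t ≥ 0 and x ∈ [0,1]: (i) ∂ₜû = ν·∂ₓₓû with boundary feedback ν·∂ₓû(t,0) = k·û(t,0), ν·∂ₓû(t,1) = −k·û(t,1), and initial condition û(0,x) = u₀(x) − r(0); (ii) ∂ₜU = ν·∂ₓₓU − U·∂ₓU + a·(û + U) − û·∂ₓû − (û·∂ₓU + U·∂ₓû) + u_d with boundary conditions ν·∂ₓU(t,0) = û(t,0)·U(t,0) + (1/2)·(û(t,0)² + U(t,0)²) and ν·∂ₓU(t,1) = û(t,1)·U(t,1) + (1/2)·(û(t,1)² + U(t,1)²) + r'(t) − ∫₀¹ [a(t,x)·(û(t,x) + U(t,x)) + u_d(t,x)] dx, and initial condition U(0,x) = r(0). Then the function u = û + U satisfies the controlled Burgers equation ∂ₜu = ν·∂ₓₓu − u·∂ₓu + a·u + u_d with u(0,x)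 = u₀(x), and the tracking error e(t) = ∫₀¹ u(t,x) dx − r(t) satisfies |e(t)| ≤ (∫₀¹ (u₀(x) − r(0))² dx)^{1/2} · e^{−λt/2} for all t ≥ 0. -/

import Mathlib

/-- Partial derivative in the first (time) variable. -/
noncomputable def pt (w : ℝ × ℝ → ℝ) (t x : ℝ) : ℝ := deriv (fun s => w (s, x)) t

/-- First partial derivative in the second (space) variable. -/
noncomputable def px (w : ℝ × ℝ → ℝ) (t x : ℝ) : ℝ := deriv (fun y => w (t, y)) x

/-- Second partial derivative in the second (space) variable. -/
noncomputable def pxx (w : ℝ × ℝ → ℝ) (t x : ℝ) : ℝ := deriv (fun y => px w t y) x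

open Set Filter Topology MeasureTheory

theorem hasDerivAt_pt {w : ℝ × ℝ → ℝ} (hw : ContDiff ℝ 1 w) (t x : ℝ) :
    HasDerivAt (fun s => w (s, x)) (pt w t x) t := by
  have hd : DifferentiableAt ℝ (fun s : ℝ => w (s, x)) t := by
    have := hw.differentiable one_ne_zero
    fun_prop
  exact hd.hasDerivAt

theorem hasDerivAt_px {w : ℝ × ℝ → ℝ} (hw : ContDiff ℝ 1 w) (t x : ℝ) :
    HasDerivAt (fun y => w (t, y)) (px w t x) x := by
  have hd : DifferentiableAt ℝ (fun y : ℝ => w (t, y)) x := by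
    have := hw.differentiable one_ne_zero
    fun_prop
  exact hd.hasDerivAt

theorem pt_eq_fderiv {w : ℝ × ℝ → ℝ} (hw : ContDiff ℝ 1 w) (t x : ℝ) :
    pt w t x = fderiv ℝ w (t, x) (1, 0) := by
  have h := (hw.differentiable one_ne_zero (t, x)).hasFDerivAt.comp_hasDerivAt t
    ((hasDerivAt_id t).prodMk (hasDerivAt_const t x))
  exact h.deriv

theorem px_eq_fderiv {w : ℝ × ℝ → ℝ} (hw : ContDiff ℝ 1 w) (t x : ℝ) :
    px w t x = fderiv ℝ w (t, x) (0, 1) := by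
  have h := (hw.differentiable one_ne_zero (t, x)).hasFDerivAt.comp_hasDerivAt x
    ((hasDerivAt_const x t).prodMk (hasDerivAt_id x))
  exact h.deriv

theorem continuous_pt {w : ℝ × ℝ → ℝ} (hw : ContDiff ℝ 1 w) :
    Continuous (fun p : ℝ × ℝ => pt w p.1 p.2) := by
  simp only [pt_eq_fderiv hw]
  exact (hw.continuous_fderiv one_ne_zero).clm_apply continuous_const

theorem continuous_px {w : ℝ × ℝ → ℝ} (hw : ContDiff ℝ 1 w) :
    Continuous (fun p : ℝ × ℝ => px w p.1 p.2) := by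
  simp only [px_eq_fderiv hw]
  exact (hw.continuous_fderiv one_ne_zero).clm_apply continuous_const

theorem contDiff_px {w : ℝ × ℝ → ℝ} (hw : ContDiff ℝ 2 w) :
    ContDiff ℝ 1 (fun p : ℝ × ℝ => px w p.1 p.2) := by
  simp only [px_eq_fderiv (hw.of_le one_le_two)]
  exact (hw.fderiv_right (m := 1) (by norm_num)).clm_apply contDiff_const

theorem hasDerivAt_pxx {w : ℝ × ℝ → ℝ} (hw : ContDiff ℝ 2 w) (t x : ℝ) :
    HasDerivAt (fun y => px w t y) (pxx w t x) x :=
  hasDerivAt_px (contDiff_px hw) t x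

theorem continuous_pxx {w : ℝ × ℝ → ℝ} (hw : ContDiff ℝ 2 w) :
    Continuous (fun p : ℝ × ℝ => pxx w p.1 p.2) :=
  continuous_px (contDiff_px hw)

/-- Differentiation under the integral sign over a compact interval. -/
theorem hasDerivAt_integral_of_continuous {F F' : ℝ × ℝ → ℝ} (hF : Continuous F)
    (hF' : Continuous F') (hd : ∀ t x, HasDerivAt (fun s => F (s, x)) (F' (t, x)) t)
    (a b t : ℝ) :
    HasDerivAt (fun s => ∫ x in a..b, F (s, x)) (∫ x in a..b, F' (t, x)) t := by
  obtain ⟨C, hC⟩ := ((isCompact_Icc (a := t - 1) (b := t + 1)).prod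
    (isCompact_uIcc (a := a) (b := b))).exists_bound_of_continuousOn hF'.continuousOn
  have hs : ∀ {G : ℝ × ℝ → ℝ}, Continuous G → ∀ s : ℝ, Continuous fun x => G (s, x) :=
    fun hG s => by fun_prop
  refine (intervalIntegral.hasDerivAt_integral_of_dominated_loc_of_deriv_le (μ := volume)
    (F := fun s x => F (s, x)) (F' := fun s x => F' (s, x)) (bound := fun _ => C)
    (Icc_mem_nhds (by linarith : t - 1 < t) (by linarith : t < t + 1))
    (Eventually.of_forall fun s => (hs hF s).aestronglyMeasurable)
    ((hs hF t).intervalIntegrable _ _) (hs hF' t).aestronglyMeasurable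
    (Eventually.of_forall fun x hx s hst => hC (s, x) ⟨hst, uIoc_subset_uIcc hx⟩)
    intervalIntegrable_const (Eventually.of_forall fun x _ s _ => hd s x)).2

/-- Cauchy–Schwarz on a subinterval of `[0, 1]`. -/
theorem sq_integral_le_integral_sq {f : ℝ → ℝ} (hf : Continuous f) {y : ℝ}
    (hy : y ∈ Icc (0 : ℝ) 1) :
    (∫ x in (0 : ℝ)..y, f x) ^ 2 ≤ ∫ x in (0 : ℝ)..1, f x ^ 2 := by
  set m := ∫ x in (0 : ℝ)..y, f x with hm
  have hi : ∀ {g : ℝ → ℝ} {c d : ℝ}, Continuous g → IntervalIntegrable g volume c d :=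
    fun hg => hg.intervalIntegrable _ _
  have h0 : 0 ≤ ∫ x in (0 : ℝ)..y, (f x - m) ^ 2 :=
    intervalIntegral.integral_nonneg hy.1 fun x _ => sq_nonneg _
  have h1 : ∫ x in (0 : ℝ)..y, (f x - m) ^ 2
      = (∫ x in (0 : ℝ)..y, f x ^ 2) - 2 * m * m + y * m ^ 2 := by
    have : ∀ x, (f x - m) ^ 2 = f x ^ 2 - 2 * m * f x + m ^ 2 := fun x => by ring
    simp only [this]
    rw [intervalIntegral.integral_add (hi (by fun_prop)) (hi (by fun_prop)),
      intervalIntegral.integral_sub (hi (by fun_prop)) (hi (by fun_prop)),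
      intervalIntegral.integral_const_mul, ← hm, intervalIntegral.integral_const]
    simp
  have h2 : (∫ x in (0 : ℝ)..y, f x ^ 2) + ∫ x in y..1, f x ^ 2 = ∫ x in (0 : ℝ)..1, f x ^ 2 :=
    intervalIntegral.integral_add_adjacent_intervals (hi (by fun_prop)) (hi (by fun_prop))
  have h3 : 0 ≤ ∫ x in y..1, f x ^ 2 :=
    intervalIntegral.integral_nonneg hy.2 fun x _ => sq_nonneg _
  nlinarith [mul_nonneg (sub_nonneg.2 hy.2) (sq_nonneg m)]

/-- A Poincaré inequality on `[0, 1]` with a boundary term. -/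
theorem integral_sq_le_of_hasDerivAt {g g' : ℝ → ℝ} (hg : Continuous g) (hg' : Continuous g')
    (hd : ∀ x, HasDerivAt g (g' x) x) :
    ∫ x in (0 : ℝ)..1, g x ^ 2 ≤ 2 * g 0 ^ 2 + 2 * ∫ x in (0 : ℝ)..1, g' x ^ 2 := by
  have hpt : ∀ y ∈ Icc (0 : ℝ) 1, g y ^ 2 ≤ 2 * g 0 ^ 2 + 2 * ∫ x in (0 : ℝ)..1, g' x ^ 2 := by
    intro y hy
    have h1 := intervalIntegral.integral_eq_sub_of_hasDerivAt (a := 0) (b := y)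
      (fun x _ => hd x) (hg'.intervalIntegrable _ _)
    have h2 := sq_integral_le_integral_sq hg' hy
    rw [h1] at h2
    nlinarith [sq_nonneg (g y - 2 * g 0)]
  calc ∫ x in (0 : ℝ)..1, g x ^ 2
      ≤ ∫ _ in (0 : ℝ)..1, (2 * g 0 ^ 2 + 2 * ∫ x in (0 : ℝ)..1, g' x ^ 2) :=
        intervalIntegral.integral_mono_on zero_le_one
          ((hg.pow 2).intervalIntegrable _ _) intervalIntegrable_const hpt
    _ = _ := by simp

/-- Exponential decay from a differential inequality. -/
theorem le_mul_exp_of_deriv_le {E E' : ℝ → ℝ} {c : ℝ} (hE : ∀ t, HasDerivAt E (E' t) t)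
    (hle : ∀ t ≥ 0, E' t ≤ -c * E t) {t : ℝ} (ht : 0 ≤ t) :
    E t ≤ E 0 * Real.exp (-c * t) := by
  have hd : ∀ s, HasDerivAt (fun s => E s * Real.exp (c * s))
      (E' s * Real.exp (c * s) + E s * (Real.exp (c * s) * (c * 1))) s := fun s =>
    (hE s).mul (((hasDerivAt_id s).const_mul c).exp)
  have hanti : AntitoneOn (fun s => E s * Real.exp (c * s)) (Ici 0) := by
    refine antitoneOn_of_deriv_nonpos (convex_Ici 0)
      (fun s _ => (hd s).continuousAt.continuousWithinAt)
      (fun s _ => (hd s).differentiableAt.differentiableWithinAt) fun s hs => ?_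
    rw [(hd s).deriv]
    have := hle s (interior_subset hs)
    nlinarith [Real.exp_pos (c * s)]
  have h := hanti (mem_Ici.2 le_rfl) (mem_Ici.2 ht) ht
  simp only [mul_zero, Real.exp_zero, mul_one] at h
  rwa [neg_mul, Real.exp_neg, ← div_eq_mul_inv, le_div_iff₀ (Real.exp_pos _)]

/-- `L²` decay for the heat equation with dissipative Robin boundary conditions. -/
theorem heat_energy_decay {ν k : ℝ} (hν : 0 < ν) (hk : 0 < k) {w : ℝ × ℝ → ℝ}
    (hw : ContDiff ℝ 2 w)
    (hpde : ∀ t ≥ (0 : ℝ), ∀ x ∈ Icc (0 : ℝ) 1, pt w t x = ν * pxx w t x)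
    (hbc0 : ∀ t ≥ (0 : ℝ), ν * px w t 0 = k * w (t, 0))
    (hbc1 : ∀ t ≥ (0 : ℝ), ν * px w t 1 = -k * w (t, 1)) {t : ℝ} (ht : 0 ≤ t) :
    ∫ x in (0 : ℝ)..1, w (t, x) ^ 2
      ≤ (∫ x in (0 : ℝ)..1, w (0, x) ^ 2) * Real.exp (-(min ν k) * t) := by
  have hw1 : ContDiff ℝ 1 w := hw.of_le one_le_two
  have cw := hw.continuous
  have cpt := continuous_pt hw1
  refine le_mul_exp_of_deriv_le (E := fun s => ∫ x in (0 : ℝ)..1, w (s, x) ^ 2)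
    (E' := fun s => ∫ x in (0 : ℝ)..1, 2 * w (s, x) * pt w s x) (fun s => ?_) (fun s hs => ?_) ht
  · refine hasDerivAt_integral_of_continuous (F := fun p => w p ^ 2)
      (F' := fun p => 2 * w p * pt w p.1 p.2) (by fun_prop) (by fun_prop) (fun s x => ?_) 0 1 s
    exact ((hasDerivAt_pt hw1 s x).pow 2).congr_deriv (by simp)
  · have cws : Continuous fun x => w (s, x) := by fun_prop
    have cpx : Continuous fun x => px w s x :=
      (continuous_px hw1).comp (Continuous.prodMk_right s)
    have cpxx : Continuous fun x => pxx w s x :=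
      (continuous_pxx hw).comp (Continuous.prodMk_right s)
    have hftc := intervalIntegral.integral_eq_sub_of_hasDerivAt (a := 0) (b := 1)
      (fun x _ => (hasDerivAt_px hw1 s x).mul (hasDerivAt_pxx hw s x))
      (Continuous.intervalIntegrable (by fun_prop) _ _)
    rw [intervalIntegral.integral_add (Continuous.intervalIntegrable (by fun_prop) _ _)
      (Continuous.intervalIntegrable (by fun_prop) _ _)] at hftc
    have hE : ∫ x in (0 : ℝ)..1, 2 * w (s, x) * pt w s x
        = 2 * ν * ∫ x in (0 : ℝ)..1, w (s, x) * pxx w s x := by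
      rw [← intervalIntegral.integral_const_mul]
      refine intervalIntegral.integral_congr fun x hx => ?_
      rw [uIcc_of_le zero_le_one] at hx
      simp only [hpde s hs x hx]
      ring
    have hP := integral_sq_le_of_hasDerivAt cws cpx (hasDerivAt_px hw1 s)
    have hD : 0 ≤ ∫ x in (0 : ℝ)..1, px w s x ^ 2 :=
      intervalIntegral.integral_nonneg zero_le_one fun x _ => sq_nonneg _
    simp only [← pow_two, Pi.mul_apply] at hftc
    have hmin : 0 < min ν k := lt_min hν hk
    have h0 := hbc0 s hs
    have h1 := hbc1 s hs
    have hE' : 2 * ν * ∫ x in (0 : ℝ)..1, w (s, x) * pxx w s x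
        = -2 * k * w (s, 1) ^ 2 - 2 * k * w (s, 0) ^ 2
          - 2 * ν * ∫ x in (0 : ℝ)..1, px w s x ^ 2 := by
      linear_combination 2 * ν * hftc + 2 * w (s, 1) * h1 - 2 * w (s, 0) * h0
    change (∫ x in (0 : ℝ)..1, 2 * w (s, x) * pt w s x)
      ≤ -(min ν k) * ∫ x in (0 : ℝ)..1, w (s, x) ^ 2
    rw [hE, hE']
    have := mul_le_mul_of_nonneg_left hP hmin.le
    have := mul_le_mul_of_nonneg_right (min_le_left ν k) hD
    have := mul_le_mul_of_nonneg_right (min_le_right ν k) (sq_nonneg (w (s, 0)))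
    have := mul_nonneg hk.le (sq_nonneg (w (s, 1)))
    linarith

/-- The spatial mean of the regulator state follows the reference signal. -/
theorem integral_regulator_eq {ν : ℝ} {a ud : ℝ × ℝ → ℝ} {r : ℝ → ℝ} {uh U : ℝ × ℝ → ℝ}
    (ha : Continuous a) (hud : Continuous ud) (hr : ContDiff ℝ 1 r)
    (huh : ContDiff ℝ 1 uh) (hU : ContDiff ℝ 2 U)
    (hpde : ∀ t ≥ (0 : ℝ), ∀ x ∈ Icc (0 : ℝ) 1,
      pt U t x = ν * pxx U t x - U (t, x) * px U t x
        + a (t, x) * (uh (t, x) + U (t, x))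
        - uh (t, x) * px uh t x
        - (uh (t, x) * px U t x + U (t, x) * px uh t x) + ud (t, x))
    (hbc0 : ∀ t ≥ (0 : ℝ),
      ν * px U t 0 = uh (t, 0) * U (t, 0)
        + (1 / 2) * ((uh (t, 0)) ^ 2 + (U (t, 0)) ^ 2))
    (hbc1 : ∀ t ≥ (0 : ℝ),
      ν * px U t 1 = uh (t, 1) * U (t, 1)
        + (1 / 2) * ((uh (t, 1)) ^ 2 + (U (t, 1)) ^ 2) + deriv r t
        - ∫ x in (0 : ℝ)..1,
            (a (t, x) * (uh (t, x) + U (t, x)) + ud (t, x)))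
    (hic : ∀ x ∈ Icc (0 : ℝ) 1, U (0, x) = r 0) {t : ℝ} (ht : 0 ≤ t) :
    ∫ x in (0 : ℝ)..1, U (t, x) = r t := by
  have hU1 : ContDiff ℝ 1 U := hU.of_le one_le_two
  have cU := hU.continuous
  have cuh := huh.continuous
  have cpt := continuous_pt hU1
  have hd : ∀ s, HasDerivAt (fun s => (∫ x in (0 : ℝ)..1, U (s, x)) - r s)
      ((∫ x in (0 : ℝ)..1, pt U s x) - deriv r s) s := fun s =>
    (hasDerivAt_integral_of_continuous (F' := fun p => pt U p.1 p.2) cU cpt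
      (hasDerivAt_pt hU1) 0 1 s).sub (hr.differentiable one_ne_zero s).hasDerivAt
  have hzero : ∀ s ≥ 0, (∫ x in (0 : ℝ)..1, pt U s x) - deriv r s = 0 := by
    intro s hs
    have cpts : Continuous fun x => pt U s x := cpt.comp (Continuous.prodMk_right s)
    have hG : ∀ x ∈ uIcc (0 : ℝ) 1, HasDerivAt
        (fun x => ν * px U s x - (1 / 2) * (uh (s, x) + U (s, x)) ^ 2)
        (pt U s x - (a (s, x) * (uh (s, x) + U (s, x)) + ud (s, x))) x := by
      intro x hx
      rw [uIcc_of_le zero_le_one] at hx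
      have h := ((hasDerivAt_pxx hU s x).const_mul ν).sub
        ((((hasDerivAt_px huh s x).add (hasDerivAt_px hU1 s x)).pow 2).const_mul (1 / 2))
      refine h.congr_deriv ?_
      rw [hpde s hs x hx]
      simp only [Pi.add_apply]
      push_cast
      ring
    have hftc := intervalIntegral.integral_eq_sub_of_hasDerivAt hG
      (Continuous.intervalIntegrable (by fun_prop) _ _)
    rw [intervalIntegral.integral_sub (cpts.intervalIntegrable _ _)
      (Continuous.intervalIntegrable (by fun_prop) _ _)] at hftc
    linear_combination hftc + hbc1 s hs - hbc0 s hs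
  have hconst := constant_of_has_deriv_right_zero (a := 0) (b := t)
    (fun s _ => (hd s).continuousAt.continuousWithinAt)
    (fun s hs => by simpa only [hzero s hs.1] using (hd s).hasDerivWithinAt)
    t (right_mem_Icc.2 ht)
  have h0 : ∫ x in (0 : ℝ)..1, U (0, x) = r 0 := by
    have : ∫ x in (0 : ℝ)..1, U (0, x) = ∫ _ in (0 : ℝ)..1, r 0 := by
      refine intervalIntegral.integral_congr fun x hx => ?_
      rw [uIcc_of_le zero_le_one] at hx
      exact hic x hx
    simpa using this
  rw [h0, sub_self] at hconst
  exact sub_eq_zero.1 hconst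

/-- Theorem 2, exponential tracking for the unstable Burgers
equation with linear boundary feedback and feedforward control. -/
theorem stmt_14 (ν k : ℝ) (hν : 0 < ν) (hk : 0 < k)
    (a ud : ℝ × ℝ → ℝ) (r u₀ : ℝ → ℝ) (uh U : ℝ × ℝ → ℝ)
    (ha : Continuous a) (hud : Continuous ud) (hr : ContDiff ℝ 1 r)
    (hu₀ : ContinuousOn u₀ (Set.Icc (0:ℝ) 1))
    (huh : ContDiff ℝ 2 uh) (hU : ContDiff ℝ 2 U)
    (huh_pde : ∀ t ≥ (0:ℝ), ∀ x ∈ Set.Icc (0:ℝ) 1,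
      pt uh t x = ν * pxx uh t x)
    (huh_bc0 : ∀ t ≥ (0:ℝ), ν * px uh t 0 = k * uh (t, 0))
    (huh_bc1 : ∀ t ≥ (0:ℝ), ν * px uh t 1 = -k * uh (t, 1))
    (huh_ic : ∀ x ∈ Set.Icc (0:ℝ) 1, uh (0, x) = u₀ x - r 0)
    (hU_pde : ∀ t ≥ (0:ℝ), ∀ x ∈ Set.Icc (0:ℝ) 1,
      pt U t x = ν * pxx U t x - U (t, x) * px U t x
        + a (t, x) * (uh (t, x) + U (t, x))
        - uh (t, x) * px uh t x
        - (uh (t, x) * px U t x + U (t, x) * px uh t x) + ud (t, x))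
    (hU_bc0 : ∀ t ≥ (0:ℝ),
      ν * px U t 0 = uh (t, 0) * U (t, 0)
        + (1/2) * ((uh (t, 0)) ^ 2 + (U (t, 0)) ^ 2))
    (hU_bc1 : ∀ t ≥ (0:ℝ),
      ν * px U t 1 = uh (t, 1) * U (t, 1)
        + (1/2) * ((uh (t, 1)) ^ 2 + (U (t, 1)) ^ 2) + deriv r t
        - ∫ x in (0:ℝ)..1,
            (a (t, x) * (uh (t, x) + U (t, x)) + ud (t, x)))
    (hU_ic : ∀ x ∈ Set.Icc (0:ℝ) 1, U (0, x) = r 0) :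
    (∀ t ≥ (0:ℝ), ∀ x ∈ Set.Icc (0:ℝ) 1,
      pt (fun p => uh p + U p) t x
        = ν * pxx (fun p => uh p + U p) t x
          - (uh (t, x) + U (t, x)) * px (fun p => uh p + U p) t x
          + a (t, x) * (uh (t, x) + U (t, x)) + ud (t, x)) ∧
    (∀ x ∈ Set.Icc (0:ℝ) 1, uh (0, x) + U (0, x) = u₀ x) ∧
    (∀ t ≥ (0:ℝ),
      |(∫ x in (0:ℝ)..1, (uh (t, x) + U (t, x))) - r t|
        ≤ Real.sqrt (∫ x in (0:ℝ)..1, (u₀ x - r 0) ^ 2) *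
            Real.exp (-(min ν k) * t / 2)) := by
  have huh1 : ContDiff ℝ 1 uh := huh.of_le one_le_two
  have hU1 : ContDiff ℝ 1 U := hU.of_le one_le_two
  have cuh := huh.continuous
  have cU := hU.continuous
  refine ⟨fun t ht x hx => ?_, fun x hx => ?_, fun t ht => ?_⟩
  · have hpx : ∀ y, px (fun p => uh p + U p) t y = px uh t y + px U t y := fun y =>
      ((hasDerivAt_px huh1 t y).add (hasDerivAt_px hU1 t y)).deriv
    have hpt : pt (fun p => uh p + U p) t x = pt uh t x + pt U t x :=
      ((hasDerivAt_pt huh1 t x).add (hasDerivAt_pt hU1 t x)).deriv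
    have hpxx : pxx (fun p => uh p + U p) t x = pxx uh t x + pxx U t x := by
      simp only [pxx, hpx]
      exact ((hasDerivAt_pxx huh t x).add (hasDerivAt_pxx hU t x)).deriv
    rw [hpt, hpxx, hpx, huh_pde t ht x hx, hU_pde t ht x hx]
    ring
  · rw [huh_ic x hx, hU_ic x hx]
    ring
  · have cuht : Continuous fun x => uh (t, x) := by fun_prop
    have hmean := integral_regulator_eq ha hud hr huh1 hU hU_pde hU_bc0 hU_bc1 hU_ic ht
    have hdecay := heat_energy_decay hν hk huh huh_pde huh_bc0 huh_bc1 ht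
    have hinit : ∫ x in (0 : ℝ)..1, uh (0, x) ^ 2 = ∫ x in (0 : ℝ)..1, (u₀ x - r 0) ^ 2 := by
      refine intervalIntegral.integral_congr fun x hx => ?_
      rw [uIcc_of_le zero_le_one] at hx
      simp only [huh_ic x hx]
    have hcs := sq_integral_le_integral_sq cuht (right_mem_Icc.2 zero_le_one)
    rw [hinit] at hdecay
    rw [intervalIntegral.integral_add (cuht.intervalIntegrable _ _)
      (Continuous.intervalIntegrable (by fun_prop) _ _), hmean, add_sub_cancel_right]
    have hexp : Real.exp (-(min ν k) * t / 2) = Real.sqrt (Real.exp (-(min ν k) * t)) :=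
      Real.exp_half _
    rw [hexp, ← Real.sqrt_mul' _ (Real.exp_pos _).le]
    exact Real.abs_le_sqrt (hcs.trans hdecay)
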